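/- arXiv:2510.03850 — 2 statements merged into one kernel-verified Lean document; each statement's English description precedes it below -/
import Mathlib

section
/- Let μ, r̂ > 0, 0 < α < 1, let L ≥ 1 be an integer, let r > 0, and let N ≥ 1 be an integer. Then the truncation error of the sum-PDF series, ε_f = (α·μ^μ/(Γ(μ)·r̂^{αμ}))^L · ∑_{i=N}^∞ δ_i · r^{αi + αμL − 1}/Γ(αi + αμL), satisfies |ε_f| < r^{−1} · (α·μ^μ·Γ(αμ)·(r/r̂)^{αμ}/Γ(μ))^L · ∑_{i=N}^∞ (2·μ·L·(r/r̂)^α·Γ(α(1+μ)))^i / Γ(iα + Lαμ), i.e., it is bounded by the corresponding tail of the Mittag-Leffler series E_{α, αμL} evaluated at 2·μ·L·(r/r̂)^α·Γ(α(1+μ)), scaled by r^{−1}·(α·μ^μ·Γ(αμ)·(r/r̂)^{αμ}/Γ(μ))^L. -/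
open MeasureTheory Real

/-- The recursively defined coefficients δ_i. -/
noncomputable def deltaCoef (α μ rh : ℝ) (L : ℕ) : ℕ → ℝ
  | 0 => Real.Gamma (α * μ) ^ L
  | (i + 1) =>
      (1 / (((i : ℝ) + 1) * Real.Gamma (α * μ))) *
        ∑ l ∈ Finset.range (i + 1),
          deltaCoef α μ rh L (i - l) *
            ((((l : ℝ) + 1) * (L : ℝ) + ((l : ℝ) + 1) - ((i : ℝ) + 1)) *
              Real.Gamma (α * (((l : ℝ) + 1) + μ)) *
              (-μ * rh ^ (-α)) ^ (l + 1) / (Nat.factorial (l + 1) : ℝ))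
  termination_by i => i
  decreasing_by omega

/-- A consequence of the log-convexity of the Gamma function, in the direction of Gautschi's
inequality. -/
theorem rpow_mul_Gamma_le {a α : ℝ} (ha : 0 < a) (hα0 : 0 < α) (hα1 : α < 1) :
    a ^ α * Gamma a ≤ (1 + (1 - α) * (α / a)) * Gamma (a + α) := by
  have haα : 0 < a + α := by positivity
  have hG : 0 < Gamma (a + α) := Gamma_pos_of_pos haα
  have hconv : a * Gamma a ≤ Gamma (a + α) * (a + α) ^ (1 - α) := by
    have h := Gamma_mul_add_mul_le_rpow_Gamma_mul_rpow_Gamma haα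
      (by positivity : 0 < a + α + 1) hα0 (sub_pos.2 hα1) (by ring)
    rw [show α * (a + α) + (1 - α) * (a + α + 1) = a + 1 by ring, Gamma_add_one ha.ne',
      Gamma_add_one haα.ne', mul_rpow haα.le hG.le] at h
    calc a * Gamma a ≤ _ := h
      _ = Gamma (a + α) ^ α * Gamma (a + α) ^ (1 - α) * (a + α) ^ (1 - α) := by ring
      _ = Gamma (a + α) * (a + α) ^ (1 - α) := by
        rw [← rpow_add hG, add_sub_cancel, rpow_one]
  have hbern : (1 + α / a) ^ (1 - α) ≤ 1 + (1 - α) * (α / a) :=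
    rpow_one_add_le_one_add_mul_self (by linarith [div_pos hα0 ha]) (by linarith) (by linarith)
  have hsplit : (a + α) ^ (1 - α) = a ^ (1 - α) * (1 + α / a) ^ (1 - α) := by
    rw [← mul_rpow ha.le (by positivity)]
    congr 1
    field_simp
  have hpow : a ^ (1 - α) * a ^ α = a := by
    rw [← rpow_add ha, sub_add_cancel, rpow_one]
  have hmul : a ^ (1 - α) * (a ^ α * Gamma a) ≤
      a ^ (1 - α) * ((1 + α / a) ^ (1 - α) * Gamma (a + α)) := by
    rw [← mul_assoc, hpow, ← mul_assoc, ← hsplit]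
    linarith
  exact (le_of_mul_le_mul_left hmul (rpow_pos_of_pos ha _)).trans
    (mul_le_mul_of_nonneg_right hbern hG.le)

theorem add_mul_sub_le_of_convexOn {S : Set ℝ} {f : ℝ → ℝ} {f' x y : ℝ} (hf : ConvexOn ℝ S f)
    (hx : x ∈ S) (hy : y ∈ S) (hf' : HasDerivAt f f' x) : f x + f' * (y - x) ≤ f y := by
  rcases lt_trichotomy x y with h | rfl | h
  · have hs := hf.le_slope_of_hasDerivAt hx hy h hf'
    rw [slope_def_field, le_div_iff₀ (sub_pos.2 h)] at hs
    linarith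
  · simp
  · have hs := hf.slope_le_of_hasDerivAt hy hx h hf'
    rw [slope_def_field, div_le_iff₀ (sub_pos.2 h)] at hs
    linarith

/-- The minimum of the Gamma function on the positive half-line is at least `3 / 4`. -/
theorem three_quarters_le_Gamma {x : ℝ} (hx : 0 < x) : 3 / 4 ≤ Gamma x := by
  set g := eulerMascheroniConstant
  have h1 := add_mul_sub_le_of_convexOn convexOn_Gamma (Set.mem_Ioi.2 one_pos) (Set.mem_Ioi.2 hx)
    hasDerivAt_Gamma_one
  have hd : HasDerivAt Gamma (1 - g) 2 := by
    have h := hasDerivAt_Gamma_nat 1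
    norm_num at h
    convert! h using 1
    ring
  have h2 := add_mul_sub_le_of_convexOn convexOn_Gamma (Set.mem_Ioi.2 two_pos) (Set.mem_Ioi.2 hx)
    hd
  rw [Gamma_one] at h1
  rw [Gamma_two] at h2
  have hg0 : 0 < g := by linarith [one_half_lt_eulerMascheroniConstant]
  have hg1 : g < 1 := by linarith [eulerMascheroniConstant_lt_two_thirds]
  nlinarith [mul_le_mul_of_nonneg_left h1 (sub_nonneg.2 hg1.le),
    mul_le_mul_of_nonneg_left h2 hg0.le, sq_nonneg (g - 1 / 2)]

theorem max_one_rpow_lt_two_mul_Gamma {a α : ℝ} (ha : 0 < a) (hα0 : 0 < α) (hα1 : α < 1) :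
    max 1 a ^ α < 2 * Gamma (a + α) := by
  have hG := three_quarters_le_Gamma (add_pos ha hα0)
  rcases le_total a 1 with h | h
  · rw [max_eq_left h, one_rpow]
    linarith
  · rw [max_eq_right h]
    have hle := rpow_mul_Gamma_le ha hα0 hα1
    have hc : (1 - α) * (α / a) ≤ 1 / 4 := by
      have : α / a ≤ α := div_le_self hα0.le h
      nlinarith [sq_nonneg (α - 1 / 2)]
    have h1 : a ^ α * (3 / 4) ≤ a ^ α * Gamma a :=
      mul_le_mul_of_nonneg_left (three_quarters_le_Gamma ha) (by positivity)
    nlinarith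

theorem Gamma_add_nat_le {a : ℝ} (ha : 0 < a) (n : ℕ) :
    Gamma (a + n) ≤ Gamma a * max 1 a ^ n * n.factorial := by
  induction n with
  | zero => simp
  | succ n ih =>
    have han : 0 < a + n := by positivity
    rw [Nat.cast_succ, ← add_assoc, Gamma_add_one han.ne', Nat.factorial_succ, pow_succ]
    push_cast
    have hm : a + n ≤ max 1 a * (n + 1) := by
      nlinarith [le_max_left 1 a, le_max_right 1 a, (Nat.cast_nonneg n : (0 : ℝ) ≤ n)]
    calc (a + n) * Gamma (a + n)
        ≤ (max 1 a * (n + 1)) * (Gamma a * max 1 a ^ n * n.factorial) :=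
          mul_le_mul hm ih (Gamma_pos_of_pos han).le (by positivity)
      _ = _ := by ring

theorem Gamma_add_mul_nat_div_factorial_le {a α : ℝ} (ha : 0 < a) (hα0 : 0 < α) (hα1 : α < 1)
    (n : ℕ) : Gamma (a + α * n) / n.factorial ≤ Gamma a * (max 1 a ^ α) ^ n := by
  have hG : 0 < Gamma a := Gamma_pos_of_pos ha
  have hm : 0 < max 1 a := lt_max_of_lt_left one_pos
  have hfac : (1 : ℝ) ≤ n.factorial := by exact_mod_cast n.factorial_pos
  rw [div_le_iff₀ (by linarith)]
  have h := Gamma_mul_add_mul_le_rpow_Gamma_mul_rpow_Gamma ha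
    (by positivity : 0 < a + (n : ℝ)) (sub_pos.2 hα1) hα0 (by ring)
  rw [show (1 - α) * a + α * (a + n) = a + α * n by ring] at h
  calc Gamma (a + α * n) ≤ Gamma a ^ (1 - α) * Gamma (a + n) ^ α := h
    _ ≤ Gamma a ^ (1 - α) * (Gamma a * max 1 a ^ n * n.factorial) ^ α := by
      gcongr
      exact Gamma_add_nat_le ha n
    _ = Gamma a * (max 1 a ^ α) ^ n * (n.factorial : ℝ) ^ α := by
      rw [mul_rpow (by positivity) (by positivity), mul_rpow hG.le (by positivity),
        ← rpow_natCast (max 1 a) n, ← rpow_mul hm.le, mul_comm (n : ℝ) α, rpow_mul hm.le,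
        rpow_natCast, ← mul_assoc, ← mul_assoc, ← rpow_add hG, sub_add_cancel, rpow_one]
    _ ≤ Gamma a * (max 1 a ^ α) ^ n * n.factorial := by
      gcongr
      exact rpow_le_self_of_one_le hfac hα1.le

/-- Summability of the Mittag-Leffler series. -/
theorem summable_pow_div_Gamma {α b x : ℝ} (hα0 : 0 < α) (hα1 : α < 1) (hb : 0 < b)
    (hx : 0 < x) : Summable fun n : ℕ => x ^ n / Gamma (n * α + b) := by
  have hlim : Filter.Tendsto (fun n : ℕ => (n : ℝ) * α + b) Filter.atTop Filter.atTop :=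
    Filter.tendsto_atTop_add_const_right _ _
      (tendsto_natCast_atTop_atTop.atTop_mul_const hα0)
  refine summable_of_ratio_norm_eventually_le (r := 1 / 2) (by norm_num) ?_
  filter_upwards [hlim.eventually_ge_atTop 1,
    ((tendsto_rpow_atTop hα0).comp hlim).eventually_ge_atTop (4 * x)] with n h1 h2
  simp only [Function.comp_apply] at h2
  have ha : 0 < (n : ℝ) * α + b := by positivity
  have hG := Gamma_pos_of_pos ha
  have hG' := Gamma_pos_of_pos (add_pos ha hα0)
  have hle := rpow_mul_Gamma_le ha hα0 hα1
  have hc : (1 - α) * (α / (n * α + b)) ≤ 1 := by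
    have : α / (n * α + b) ≤ α := div_le_self hα0.le h1
    nlinarith [sq_nonneg (α - 1 / 2)]
  have hkey : x * Gamma (n * α + b) ≤ 1 / 2 * Gamma (n * α + b + α) := by nlinarith
  rw [show ((n + 1 : ℕ) : ℝ) * α + b = n * α + b + α by push_cast; ring,
    norm_of_nonneg (by positivity), norm_of_nonneg (by positivity), ← mul_div_assoc,
    div_le_div_iff₀ hG' hG, pow_succ]
  nlinarith [mul_le_mul_of_nonneg_left hkey (pow_pos hx n).le]

/-- Miller's recurrence for the coefficients of a power of a power series. -/
theorem PowerSeries.coeff_succ_pow_mul {K : Type*} [CommRing K] (A : PowerSeries K) (L i : ℕ) :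
    ((i : K) + 1) * coeff 0 A * coeff (i + 1) (A ^ L) =
      ∑ l ∈ Finset.range (i + 1), coeff (i - l) (A ^ L) *
        ((((l : K) + 1) * L + ((l : K) + 1) - ((i : K) + 1)) * coeff (l + 1) A) := by
  have hD : A * derivative K (A ^ L) = (L : PowerSeries K) * (derivative K A * A ^ L) := by
    rcases L with _ | L
    · simp
    · rw [derivative_pow, Nat.add_sub_cancel]
      ring
  have h := congrArg (coeff i) hD
  rw [← map_natCast (C (R := K)), coeff_C_mul, coeff_mul, coeff_mul,
    Finset.Nat.sum_antidiagonal_eq_sum_range_succ_mk,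
    Finset.Nat.sum_antidiagonal_eq_sum_range_succ_mk, Finset.sum_range_succ'] at h
  simp only [coeff_derivative, Nat.sub_zero] at h
  have hlast : ∑ l ∈ Finset.range i,
        coeff (l + 1) A * (coeff (i - (l + 1) + 1) (A ^ L) * (((i - (l + 1) : ℕ) : K) + 1)) =
      ∑ l ∈ Finset.range (i + 1), coeff (l + 1) A * (coeff (i - l) (A ^ L) * ((i : K) - l)) := by
    rw [Finset.sum_range_succ, sub_self, mul_zero, mul_zero, add_zero]
    refine Finset.sum_congr rfl fun l hl => ?_
    have hl' : l + 1 ≤ i := Finset.mem_range.1 hl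
    rw [show i - (l + 1) + 1 = i - l by omega, Nat.cast_sub hl']
    push_cast
    ring
  rw [hlast] at h
  calc ((i : K) + 1) * coeff 0 A * coeff (i + 1) (A ^ L)
      = coeff 0 A * (coeff (i + 1) (A ^ L) * ((i : K) + 1)) := by ring
    _ = _ := by
      rw [eq_sub_iff_add_eq'.2 h, Finset.mul_sum, ← Finset.sum_sub_distrib]
      refine Finset.sum_congr rfl fun l _ => ?_
      ring

theorem PowerSeries.abs_coeff_pow_le {A : PowerSeries ℝ} {G D : ℝ} (hG : 0 ≤ G) (hD : 0 ≤ D)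
    (hA : ∀ n, |coeff n A| ≤ G * D ^ n) (L n : ℕ) :
    |coeff n (A ^ L)| ≤ G ^ L * (D * L) ^ n := by
  induction L generalizing n with
  | zero => rcases n with _ | n <;> simp [coeff_one]
  | succ L ih =>
    rw [pow_succ, coeff_mul, Finset.Nat.sum_antidiagonal_eq_sum_range_succ_mk]
    calc |∑ k ∈ Finset.range n.succ, coeff k (A ^ L) * coeff (n - k) A|
        ≤ ∑ k ∈ Finset.range (n + 1), |coeff k (A ^ L) * coeff (n - k) A| :=
          Finset.abs_sum_le_sum_abs _ _
      _ ≤ ∑ k ∈ Finset.range (n + 1), G ^ (L + 1) * D ^ n * (L : ℝ) ^ k := by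
        refine Finset.sum_le_sum fun k hk => ?_
        have hk' : k ≤ n := Nat.lt_succ_iff.1 (Finset.mem_range.1 hk)
        rw [abs_mul]
        refine (mul_le_mul (ih k) (hA (n - k)) (abs_nonneg _) (by positivity)).trans_eq ?_
        rw [mul_pow, ← pow_mul_pow_sub D hk']
        ring
      _ = G ^ (L + 1) * D ^ n * ∑ k ∈ Finset.range (n + 1), (L : ℝ) ^ k := by
        rw [Finset.mul_sum]
      _ ≤ G ^ (L + 1) * D ^ n * ((L : ℝ) + 1) ^ n := by
        gcongr
        rw [add_pow]
        refine Finset.sum_le_sum fun k hk => ?_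
        have hk' : k ≤ n := Nat.lt_succ_iff.1 (Finset.mem_range.1 hk)
        rw [one_pow, mul_one]
        exact le_mul_of_one_le_right (by positivity)
          (by exact_mod_cast Nat.choose_pos hk')
      _ = G ^ (L + 1) * (D * ((L + 1 : ℕ) : ℝ)) ^ n := by
        push_cast
        rw [mul_pow D]
        ring

theorem deltaCoef_eq_coeff_pow {α μ : ℝ} (hαμ : 0 < α * μ) (rh : ℝ) (L i : ℕ) :
    deltaCoef α μ rh L i =
      PowerSeries.coeff i ((PowerSeries.mk fun l : ℕ =>
        Gamma (α * ((l : ℝ) + μ)) * (-μ * rh ^ (-α)) ^ l / (l.factorial : ℝ)) ^ L) := by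
  induction i using Nat.strong_induction_on with
  | _ i ih =>
    rcases i with _ | i
    · simp [deltaCoef]
    · have hG := (Gamma_pos_of_pos hαμ).ne'
      have hi : (i : ℝ) + 1 ≠ 0 := by positivity
      rw [deltaCoef]
      have h := PowerSeries.coeff_succ_pow_mul (PowerSeries.mk fun l : ℕ =>
        Gamma (α * ((l : ℝ) + μ)) * (-μ * rh ^ (-α)) ^ l / (l.factorial : ℝ)) L i
      have h0 : PowerSeries.coeff 0 (PowerSeries.mk fun l : ℕ =>
          Gamma (α * ((l : ℝ) + μ)) * (-μ * rh ^ (-α)) ^ l / (l.factorial : ℝ)) =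
          Gamma (α * μ) := by simp
      rw [h0] at h
      rw [one_div_mul_eq_div, div_eq_iff (mul_ne_zero hi hG), mul_comm (PowerSeries.coeff _ _), h]
      refine Finset.sum_congr rfl fun l _ => ?_
      rw [ih (i - l) (by omega), PowerSeries.coeff_mk]
      push_cast
      ring

theorem abs_deltaCoef_le {α μ rh : ℝ} (hμ : 0 < μ) (hrh : 0 < rh) (hα0 : 0 < α) (hα1 : α < 1)
    (L n : ℕ) : |deltaCoef α μ rh L n| ≤
      Gamma (α * μ) ^ L * (μ * rh ^ (-α) * max 1 (α * μ) ^ α * L) ^ n := by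
  have hαμ : 0 < α * μ := mul_pos hα0 hμ
  rw [deltaCoef_eq_coeff_pow hαμ]
  have hm : 0 < max 1 (α * μ) := lt_max_of_lt_left one_pos
  refine PowerSeries.abs_coeff_pow_le (Gamma_pos_of_pos hαμ).le (by positivity) (fun l => ?_) L n
  have hG : 0 < Gamma (α * μ + α * l) := Gamma_pos_of_pos (by positivity)
  have hc : 0 ≤ (μ * rh ^ (-α)) ^ l := by positivity
  rw [PowerSeries.coeff_mk, abs_div, abs_mul, abs_pow, neg_mul, abs_neg,
    abs_of_pos (mul_pos hμ (rpow_pos_of_pos hrh _)), Nat.abs_cast,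
    show α * ((l : ℝ) + μ) = α * μ + α * l by ring, abs_of_pos hG]
  calc _ = (μ * rh ^ (-α)) ^ l * (Gamma (α * μ + α * l) / l.factorial) := by ring
    _ ≤ (μ * rh ^ (-α)) ^ l * (Gamma (α * μ) * (max 1 (α * μ) ^ α) ^ l) :=
      mul_le_mul_of_nonneg_left (Gamma_add_mul_nat_div_factorial_le hαμ hα0 hα1 l) hc
    _ = _ := by rw [mul_pow _ (max 1 (α * μ) ^ α)]; ring

theorem abs_deltaCoef_lt {α μ rh : ℝ} (hμ : 0 < μ) (hrh : 0 < rh) (hα0 : 0 < α) (hα1 : α < 1)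
    {L n : ℕ} (hL : 1 ≤ L) (hn : 1 ≤ n) : |deltaCoef α μ rh L n| <
      Gamma (α * μ) ^ L * (2 * μ * L * rh ^ (-α) * Gamma (α * (1 + μ))) ^ n := by
  have hαμ : 0 < α * μ := mul_pos hα0 hμ
  have hL' : (0 : ℝ) < L := by exact_mod_cast hL
  refine (abs_deltaCoef_le hμ hrh hα0 hα1 L n).trans_lt ?_
  have hlt := max_one_rpow_lt_two_mul_Gamma hαμ hα0 hα1
  have hG := Gamma_pos_of_pos hαμ
  have hm : 0 < max 1 (α * μ) := lt_max_of_lt_left one_pos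
  have hc : 0 < μ * rh ^ (-α) * L := by positivity
  gcongr ?_ * ?_
  refine pow_lt_pow_left₀ ?_ (by positivity) (by omega)
  calc _ = μ * rh ^ (-α) * L * max 1 (α * μ) ^ α := by ring
    _ < μ * rh ^ (-α) * L * (2 * Gamma (α * μ + α)) := mul_lt_mul_of_pos_left hlt hc
    _ = _ := by rw [show α * (1 + μ) = α * μ + α by ring]; ring

theorem abs_sum_pdf_term_lt {α μ rh r : ℝ} (hμ : 0 < μ) (hrh : 0 < rh) (hα0 : 0 < α)
    (hα1 : α < 1) (hr : 0 < r) {L n : ℕ} (hL : 1 ≤ L) (hn : 1 ≤ n) :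
    |(α * μ ^ μ / (Gamma μ * rh ^ (α * μ))) ^ L *
        (deltaCoef α μ rh L n * r ^ (α * n + α * μ * L - 1) / Gamma (α * n + α * μ * L))| <
      r ^ (-1 : ℝ) *
        (α * μ ^ μ * Gamma (α * μ) * (r / rh) ^ (α * μ) / Gamma μ) ^ L *
        ((2 * μ * L * (r / rh) ^ α * Gamma (α * (1 + μ))) ^ n / Gamma (n * α + L * α * μ)) := by
  have hL' : (0 : ℝ) < L := by exact_mod_cast hL
  have hG : 0 < Gamma (α * n + α * μ * L) := Gamma_pos_of_pos (by positivity)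
  have hGμ : 0 < Gamma μ := Gamma_pos_of_pos hμ
  have hK : 0 < (α * μ ^ μ / (Gamma μ * rh ^ (α * μ))) ^ L := by positivity
  have hR : 0 < r ^ (α * n + α * μ * L - 1) := by positivity
  have hpow : r ^ (α * n + α * μ * L - 1) = (r ^ α) ^ n * (r ^ (α * μ)) ^ L * r ^ (-1 : ℝ) := by
    rw [sub_eq_add_neg, rpow_add hr, rpow_add hr, rpow_mul hr.le α, rpow_mul hr.le (α * μ),
      rpow_natCast, rpow_natCast]
  rw [abs_mul, abs_div, abs_mul, abs_of_pos hK, abs_of_pos hR, abs_of_pos hG,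
    show (n : ℝ) * α + L * α * μ = α * n + α * μ * L by ring]
  calc _ < (α * μ ^ μ / (Gamma μ * rh ^ (α * μ))) ^ L *
        (Gamma (α * μ) ^ L * (2 * μ * L * rh ^ (-α) * Gamma (α * (1 + μ))) ^ n *
          r ^ (α * n + α * μ * L - 1) / Gamma (α * n + α * μ * L)) := by
        gcongr
        exact abs_deltaCoef_lt hμ hrh hα0 hα1 hL hn
    _ = _ := by
      rw [hpow, div_rpow hr.le hrh.le, div_rpow hr.le hrh.le, rpow_neg hrh.le α]
      simp only [mul_pow, div_pow, inv_pow]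
      field_simp

theorem abs_tsum_lt_tsum {f g : ℕ → ℝ} (h : ∀ i, |f i| < g i) (hg : Summable g) :
    |∑' i, f i| < ∑' i, g i := by
  have hf : Summable fun i => |f i| :=
    Summable.of_nonneg_of_le (fun _ => abs_nonneg _) (fun i => (h i).le) hg
  have hle : |∑' i, f i| ≤ ∑' i, |f i| := by
    simpa only [norm_eq_abs] using norm_tsum_le_tsum_norm hf.of_abs.norm
  exact hle.trans_lt (Summable.tsum_lt_tsum (i := 0) (fun i => (h i).le) (h 0) hf hg)

/-- Truncation-error bound for the sum-PDF series, case 0 < α < 1. -/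
theorem sum_pdf_truncation_bound_of_alpha_lt_one
    (α μ rh : ℝ) (hμ : 0 < μ) (hrh : 0 < rh) (hα0 : 0 < α) (hα1 : α < 1)
    (L : ℕ) (hL : 1 ≤ L) (r : ℝ) (hr : 0 < r) (N : ℕ) (hN : 1 ≤ N) :
    |(α * μ ^ μ / (Real.Gamma μ * rh ^ (α * μ))) ^ L *
        ∑' i : ℕ,
          deltaCoef α μ rh L (N + i) *
            r ^ (α * ((N : ℝ) + (i : ℝ)) + α * μ * (L : ℝ) - 1) /
            Real.Gamma (α * ((N : ℝ) + (i : ℝ)) + α * μ * (L : ℝ))| <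
      r ^ (-1 : ℝ) *
        (α * μ ^ μ * Real.Gamma (α * μ) * (r / rh) ^ (α * μ) / Real.Gamma μ) ^ L *
        ∑' i : ℕ,
          (2 * μ * (L : ℝ) * (r / rh) ^ α * Real.Gamma (α * (1 + μ))) ^ (N + i) /
            Real.Gamma (((N : ℝ) + (i : ℝ)) * α + (L : ℝ) * α * μ) := by
  have hL' : (0 : ℝ) < L := by exact_mod_cast hL
  have hx : 0 < 2 * μ * (L : ℝ) * (r / rh) ^ α * Gamma (α * (1 + μ)) := by
    have : 0 < Gamma (α * (1 + μ)) := Gamma_pos_of_pos (by positivity)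
    positivity
  have hsum := ((summable_pow_div_Gamma hα0 hα1 (b := (L : ℝ) * α * μ) (by positivity)
    hx).comp_injective (add_right_injective N)).mul_left (r ^ (-1 : ℝ) *
      (α * μ ^ μ * Gamma (α * μ) * (r / rh) ^ (α * μ) / Gamma μ) ^ L)
  rw [← tsum_mul_left, ← tsum_mul_left]
  simp only [Function.comp_apply] at hsum
  simp only [← Nat.cast_add]
  exact abs_tsum_lt_tsum (fun i =>
    abs_sum_pdf_term_lt hμ hrh hα0 hα1 hr hL (hN.trans (Nat.le_add_right N i))) hsum
end

section
/- Let μ, r̂ > 0, α ≥ 1, let L ≥ 1 be an integer, let r > 0, and let N ≥ 1 be an integer. Then the truncation error of the sum-PDF series, ε_f = (α·μ^μ/(Γ(μ)·r̂^{αμ}))^L · ∑_{i=N}^∞ δ_i · r^{αi + αμL − 1}/Γ(αi + αμL), satisfies |ε_f| < (2L/r) · (α·μ^μ·Γ(αμ)·(r/r̂)^{αμ}/Γ(μ))^L · exp(μ·(r/r̂)^α) · γ(N, μ·(r/r̂)^α) / Γ(N), where γ(s, x) = ∫_0^x t^{s−1} e^{−t} dt is the lower incomplete gamma function. -/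
open MeasureTheory Real

/-- The lower incomplete gamma function γ(s, x) = ∫_0^x t^(s−1) e^(−t) dt. -/
noncomputable def lowerGamma (s x : ℝ) : ℝ :=
  ∫ t in (0 : ℝ)..x, t ^ (s - 1) * Real.exp (-t)

/-- `Γ` stays above `1/2` on the positive reals. -/
theorem half_lt_Gamma {y : ℝ} (hy : 0 < y) : 1 / 2 < Real.Gamma y := by
  have one_le {z : ℝ} (hz : 2 ≤ z) : 1 ≤ Real.Gamma z := by
    have h := Real.Gamma_strictMonoOn_Ici.monotoneOn (Set.mem_Ici.2 le_rfl) (Set.mem_Ici.2 hz) hz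
    rwa [Real.Gamma_two] at h
  have of_one_le {z : ℝ} (hz : 1 ≤ z) : 1 / 2 < Real.Gamma z := by
    rcases le_or_gt 2 z with h | h
    · linarith [one_le h]
    · have h1 : 1 ≤ z * Real.Gamma z := by
        rw [← Real.Gamma_add_one (by positivity)]
        exact one_le (by linarith)
      nlinarith
  rcases le_or_gt 1 y with h | h
  · exact of_one_le h
  · have h1 : 1 / 2 < y * Real.Gamma y := by
      rw [← Real.Gamma_add_one hy.ne']
      exact of_one_le (by linarith)
    nlinarith [Real.Gamma_pos_of_pos hy]

theorem hasDerivAt_exp_neg_mul_sum_range (n : ℕ) (x : ℝ) :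
    HasDerivAt
      (fun t : ℝ => -(Real.exp (-t) * ∑ k ∈ Finset.range (n + 1), t ^ k / (k.factorial : ℝ)))
      (x ^ n / (n.factorial : ℝ) * Real.exp (-x)) x := by
  have hexp : HasDerivAt (fun t : ℝ => Real.exp (-t)) (-Real.exp (-x)) x := by
    simpa using (hasDerivAt_neg x).exp
  induction n with
  | zero => simpa using hexp.fun_neg
  | succ n ih =>
    have hpow := (hexp.mul ((hasDerivAt_pow (n + 1) x).div_const ((n + 1).factorial : ℝ))).neg
    refine ((ih.add hpow).congr_deriv ?_).congr_of_eventuallyEq (.of_forall fun t => ?_)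
    · have h : ((n.factorial : ℕ) : ℝ) ≠ 0 := by positivity
      have h' : (n : ℝ) + 1 ≠ 0 := by positivity
      simp only [Nat.factorial_succ, Nat.cast_mul, Nat.cast_add, Nat.cast_one,
        Nat.add_sub_cancel]
      field_simp
      ring
    · simp only [Finset.sum_range_succ _ (n + 1), Pi.add_apply, Pi.neg_apply, Pi.mul_apply]
      ring

/-- The lower incomplete gamma function at a positive integer is a tail of the exponential
series. -/
theorem hasSum_pow_div_factorial_tail_lowerGamma {N : ℕ} (hN : 1 ≤ N) (x : ℝ) :
    HasSum (fun i : ℕ => x ^ (N + i) / ((N + i).factorial : ℝ))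
      (Real.exp x * lowerGamma N x / Real.Gamma N) := by
  obtain ⟨n, rfl⟩ := Nat.exists_eq_add_of_le' hN
  have hn : ((n.factorial : ℕ) : ℝ) ≠ 0 := by positivity
  have hint : lowerGamma ((n + 1 : ℕ) : ℝ) x =
      n.factorial *
        (1 - Real.exp (-x) * ∑ k ∈ Finset.range (n + 1), x ^ k / (k.factorial : ℝ)) := by
    have h := intervalIntegral.integral_eq_sub_of_hasDerivAt (a := 0) (b := x)
      (fun t _ => hasDerivAt_exp_neg_mul_sum_range n t)
      (Continuous.intervalIntegrable (by fun_prop) _ _)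
    have h0 : ∑ k ∈ Finset.range (n + 1), (0 : ℝ) ^ k / (k.factorial : ℝ) = 1 := by
      simp [Finset.sum_range_succ']
    rw [h0] at h
    simp only [neg_zero, Real.exp_zero, mul_one, sub_neg_eq_add] at h
    rw [lowerGamma, sub_eq_neg_add 1, ← h, ← intervalIntegral.integral_const_mul]
    congr 1 with t
    rw [Nat.cast_add_one, add_sub_cancel_right, Real.rpow_natCast]
    field_simp
  have hexp : HasSum (fun k : ℕ => x ^ k / (k.factorial : ℝ)) (Real.exp x) := by
    rw [Real.exp_eq_exp_ℝ]
    exact NormedSpace.expSeries_div_hasSum_exp x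
  have htail := (hasSum_nat_add_iff' (n + 1)).2 hexp
  convert! htail using 1
  · simp only [add_comm]
  · rw [hint, Nat.cast_add_one, Real.Gamma_nat_eq_factorial, Real.exp_neg]
    field_simp

/-- J. C. P. Miller's recurrence for the coefficients of a power of a power series. -/
theorem PowerSeries.succ_mul_coeff_zero_mul_coeff_pow {R : Type*} [CommRing R] (P : PowerSeries R)
    (L i : ℕ) :
    ((i : R) + 1) * P.coeff 0 * (P ^ L).coeff (i + 1) =
      ∑ l ∈ Finset.range (i + 1), (P ^ L).coeff (i - l) *
        ((((l : R) + 1) * L + (l + 1) - (i + 1)) * P.coeff (l + 1)) := by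
  have key : P * (PowerSeries.derivative R) (P ^ L) =
      (L : PowerSeries R) * ((PowerSeries.derivative R) P * P ^ L) := by
    rw [PowerSeries.derivative_pow]
    cases L with
    | zero => simp
    | succ L => simp only [Nat.add_sub_cancel]; ring
  have h := congrArg (PowerSeries.coeff i) key
  rw [← map_natCast (PowerSeries.C (R := R)), PowerSeries.coeff_C_mul, PowerSeries.coeff_mul,
    PowerSeries.coeff_mul, Finset.Nat.sum_antidiagonal_eq_sum_range_succ_mk,
    Finset.Nat.sum_antidiagonal_eq_sum_range_succ_mk] at h
  simp only [PowerSeries.coeff_derivative] at h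
  rw [Finset.sum_range_succ'] at h
  have hsplit : ∀ l ∈ Finset.range (i + 1), (P ^ L).coeff (i - l) *
        ((((l : R) + 1) * L + (l + 1) - (i + 1)) * P.coeff (l + 1)) =
      L * (P.coeff (l + 1) * (l + 1) * (P ^ L).coeff (i - l)) -
        ((i : R) - l) * P.coeff (l + 1) * (P ^ L).coeff (i - l) := fun l _ => by ring
  rw [Finset.sum_congr rfl hsplit, Finset.sum_sub_distrib, ← Finset.mul_sum, ← h,
    Finset.sum_range_succ (fun l => ((i : R) - l) * P.coeff (l + 1) * (P ^ L).coeff (i - l))]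
  have hshift : ∀ l ∈ Finset.range i,
      P.coeff (l + 1) * ((P ^ L).coeff (i - (l + 1) + 1) * (((i - (l + 1) : ℕ) : R) + 1)) =
        ((i : R) - l) * P.coeff (l + 1) * (P ^ L).coeff (i - l) := fun l hl => by
    have hl := Finset.mem_range.1 hl
    have h1 : i - (l + 1) + 1 = i - l := by omega
    rw [← Nat.cast_add_one, h1, Nat.cast_sub hl.le]
    ring
  rw [Finset.sum_congr rfl hshift]
  simp
  ring

/-- The power series whose `L`-th power has the coefficients `deltaCoef α μ rh L`. -/
noncomputable def deltaSeries (α μ rh : ℝ) : PowerSeries ℝ :=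
  PowerSeries.mk fun l => Real.Gamma (α * (l + μ)) * (-μ * rh ^ (-α)) ^ l / (l.factorial : ℝ)

theorem deltaCoef_eq_coeff_pow_s11 {α μ : ℝ} (rh : ℝ) (h : 0 < α * μ) (L i : ℕ) :
    deltaCoef α μ rh L i = (deltaSeries α μ rh ^ L).coeff i := by
  have h0 : (deltaSeries α μ rh).coeff 0 = Real.Gamma (α * μ) := by simp [deltaSeries]
  induction i using Nat.strong_induction_on with
  | _ i ih =>
    cases i with
    | zero =>
      rw [deltaCoef, ← h0]
      simp
    | succ i =>
      have hrec := (deltaSeries α μ rh).succ_mul_coeff_zero_mul_coeff_pow L i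
      rw [h0] at hrec
      rw [deltaCoef, one_div_mul_eq_div, div_eq_iff (by positivity),
        mul_comm (PowerSeries.coeff _ _), hrec]
      refine Finset.sum_congr rfl fun l _ => ?_
      rw [ih (i - l) (by omega), deltaSeries, PowerSeries.coeff_mk]
      push_cast
      ring

theorem intervalIntegrable_beta {u v : ℝ} (hu : 0 < u) (hv : 0 < v) :
    IntervalIntegrable (fun t : ℝ => t ^ (u - 1) * (1 - t) ^ (v - 1)) volume 0 1 := by
  have h := Complex.betaIntegral_convergent (u := u) (v := v) (by simpa) (by simpa)
  rw [intervalIntegrable_iff_integrableOn_Ioc_of_le zero_le_one] at h ⊢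
  refine IntegrableOn.congr_fun h.re (fun t ht => ?_) measurableSet_Ioc
  have h1 : (0 : ℝ) ≤ 1 - t := by linarith [ht.2]
  have : (t : ℂ) ^ ((u : ℂ) - 1) * (1 - (t : ℂ)) ^ ((v : ℂ) - 1) =
      ((t ^ (u - 1) * (1 - t) ^ (v - 1) : ℝ) : ℂ) := by
    push_cast [Complex.ofReal_cpow ht.1.le, Complex.ofReal_cpow h1]
    rfl
  simp [this]

theorem integral_beta {u v : ℝ} (hu : 0 < u) (hv : 0 < v) :
    ∫ t in (0 : ℝ)..1, t ^ (u - 1) * (1 - t) ^ (v - 1) =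
      Real.Gamma u * Real.Gamma v / Real.Gamma (u + v) := by
  have h := ProbabilityTheory.beta_eq_betaIntegralReal u v hu hv
  rw [ProbabilityTheory.beta] at h
  rw [h, Complex.betaIntegral]
  have : ∫ t in (0 : ℝ)..1, (t : ℂ) ^ ((u : ℂ) - 1) * (1 - (t : ℂ)) ^ ((v : ℂ) - 1) =
      ∫ t in (0 : ℝ)..1, ((t ^ (u - 1) * (1 - t) ^ (v - 1) : ℝ) : ℂ) := by
    refine intervalIntegral.integral_congr fun t ht => ?_
    rw [Set.uIcc_of_le zero_le_one] at ht
    have h1 : (0 : ℝ) ≤ 1 - t := by linarith [ht.2]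
    push_cast [Complex.ofReal_cpow ht.1, Complex.ofReal_cpow h1]
    rfl
  rw [this, intervalIntegral.integral_ofReal, Complex.ofReal_re]

/-- Binomial convolution of Gamma values, bounded through the Beta integral and
`t ^ α + (1 - t) ^ α ≤ 1`. -/
theorem sum_choose_mul_Gamma_mul_Gamma_le {α u v : ℝ} (hα : 1 ≤ α) (hu : 0 < u) (hv : 0 < v)
    (i : ℕ) :
    ∑ j ∈ Finset.range (i + 1),
        (i.choose j : ℝ) * (Real.Gamma (α * j + u) * Real.Gamma (α * (i - j : ℕ) + v)) ≤
      Real.Gamma (α * i + (u + v)) * (Real.Gamma u * Real.Gamma v / Real.Gamma (u + v)) := by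
  have hα0 : 0 < α := by linarith
  have hΓ : 0 < Real.Gamma (α * i + (u + v)) := Real.Gamma_pos_of_pos (by positivity)
  have hterm : ∀ j ∈ Finset.range (i + 1),
      (i.choose j : ℝ) * (Real.Gamma (α * j + u) * Real.Gamma (α * (i - j : ℕ) + v)) =
        Real.Gamma (α * i + (u + v)) * ∫ t in (0 : ℝ)..1, (i.choose j : ℝ) *
          (t ^ (α * j + u - 1) * (1 - t) ^ (α * (i - j : ℕ) + v - 1)) := fun j hj => by
    have hj : j ≤ i := Nat.lt_succ_iff.1 (Finset.mem_range.1 hj)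
    rw [intervalIntegral.integral_const_mul, integral_beta (by positivity) (by positivity)]
    have : α * j + u + (α * (i - j : ℕ) + v) = α * i + (u + v) := by
      rw [Nat.cast_sub hj]; ring
    rw [this]
    field_simp
  have hint : ∀ j ∈ Finset.range (i + 1), IntervalIntegrable (fun t : ℝ => (i.choose j : ℝ) *
      (t ^ (α * j + u - 1) * (1 - t) ^ (α * (i - j : ℕ) + v - 1))) volume 0 1 := fun j _ =>
    (intervalIntegrable_beta (by positivity) (by positivity)).const_mul _
  rw [Finset.sum_congr rfl hterm, ← Finset.mul_sum, ← intervalIntegral.integral_finsetSum hint,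
    ← integral_beta hu hv]
  refine mul_le_mul_of_nonneg_left (intervalIntegral.integral_mono_on_of_le_Ioo zero_le_one
    (by simpa only [Finset.sum_fn] using IntervalIntegrable.sum _ hint)
    (intervalIntegrable_beta hu hv) fun t ht => ?_) hΓ.le
  have ht0 : 0 < t := ht.1
  have ht1 : 0 < 1 - t := by linarith [ht.2]
  have hpow : ∀ j ∈ Finset.range (i + 1), (i.choose j : ℝ) *
      (t ^ (α * j + u - 1) * (1 - t) ^ (α * (i - j : ℕ) + v - 1)) =
      (t ^ α) ^ j * ((1 - t) ^ α) ^ (i - j) * (i.choose j : ℝ) *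
        (t ^ (u - 1) * (1 - t) ^ (v - 1)) := fun j _ => by
    rw [add_sub_assoc, add_sub_assoc, Real.rpow_add ht0, Real.rpow_add ht1, Real.rpow_mul ht0.le,
      Real.rpow_mul ht1.le, Real.rpow_natCast, Real.rpow_natCast]
    ring
  rw [Finset.sum_congr rfl hpow, ← Finset.sum_mul, ← add_pow]
  refine mul_le_of_le_one_left (by positivity) (pow_le_one₀ (by positivity) ?_)
  have h1 : t ^ α ≤ t := by
    simpa using Real.rpow_le_rpow_of_exponent_ge ht0 (by linarith) hα
  have h2 : (1 - t) ^ α ≤ 1 - t := by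
    simpa using Real.rpow_le_rpow_of_exponent_ge ht1 (by linarith) hα
  linarith

theorem abs_coeff_deltaSeries_pow_le {α μ rh : ℝ} (hα : 1 ≤ α) (hμ : 0 < μ) (hrh : 0 < rh)
    {L : ℕ} (hL : 1 ≤ L) (i : ℕ) :
    |(deltaSeries α μ rh ^ L).coeff i| ≤
      Real.Gamma (α * μ) ^ L / Real.Gamma (α * μ * L) * Real.Gamma (α * i + α * μ * L) *
        ((μ * rh ^ (-α)) ^ i / (i.factorial : ℝ)) := by
  have hα0 : 0 < α := by linarith
  have ha : 0 < α * μ := by positivity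
  have hΓ := Real.Gamma_pos_of_pos ha
  have hcoeff (l : ℕ) : |(deltaSeries α μ rh).coeff l| =
      Real.Gamma (α * l + α * μ) * ((μ * rh ^ (-α)) ^ l / (l.factorial : ℝ)) := by
    have h : 0 < Real.Gamma (α * l + α * μ) := Real.Gamma_pos_of_pos (by positivity)
    rw [deltaSeries, PowerSeries.coeff_mk, mul_add, mul_div_assoc, abs_mul, abs_of_pos h, abs_div,
      abs_pow, Nat.abs_cast, neg_mul, abs_neg, abs_of_pos (by positivity)]
  induction L, hL using Nat.le_induction generalizing i with
  | base =>
    rw [pow_one, hcoeff]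
    simp [hΓ.ne']
  | succ L hL ih =>
    have hL0 : (0 : ℝ) < L := by exact_mod_cast hL
    have hΓL : 0 < Real.Gamma (α * μ * L) := Real.Gamma_pos_of_pos (by positivity)
    set y := μ * rh ^ (-α) with hy
    have hy0 : 0 < y := by positivity
    rw [pow_succ, PowerSeries.coeff_mul, Finset.Nat.sum_antidiagonal_eq_sum_range_succ_mk]
    calc
      _ ≤ ∑ j ∈ Finset.range (i + 1), Real.Gamma (α * μ) ^ L / Real.Gamma (α * μ * L) *
          (y ^ i / (i.factorial : ℝ)) * ((i.choose j : ℝ) *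
            (Real.Gamma (α * j + α * μ * L) * Real.Gamma (α * (i - j : ℕ) + α * μ))) := by
        refine (Finset.abs_sum_le_sum_abs _ _).trans (Finset.sum_le_sum fun j hj => ?_)
        have hj : j ≤ i := Nat.lt_succ_iff.1 (Finset.mem_range.1 hj)
        rw [abs_mul, hcoeff]
        refine (mul_le_mul_of_nonneg_right (ih j) ?_).trans_eq ?_
        · rw [← hcoeff]; exact abs_nonneg _
        · rw [Nat.cast_choose ℝ hj, ← pow_mul_pow_sub y hj]
          field_simp
      _ ≤ _ := by
        rw [← Finset.mul_sum]
        refine (mul_le_mul_of_nonneg_left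
          (sum_choose_mul_Gamma_mul_Gamma_le hα (u := α * μ * L) (by positivity) ha i)
          (by positivity)).trans_eq ?_
        rw [Nat.cast_add_one, mul_add_one (α * μ), pow_succ]
        field_simp

/-- Truncation-error bound for the sum-PDF series, case α ≥ 1. -/
theorem sum_pdf_truncation_bound_of_one_le_alpha
    (α μ rh : ℝ) (hμ : 0 < μ) (hrh : 0 < rh) (hα : 1 ≤ α)
    (L : ℕ) (hL : 1 ≤ L) (r : ℝ) (hr : 0 < r) (N : ℕ) (hN : 1 ≤ N) :
    |(α * μ ^ μ / (Real.Gamma μ * rh ^ (α * μ))) ^ L *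
        ∑' i : ℕ,
          deltaCoef α μ rh L (N + i) *
            r ^ (α * ((N : ℝ) + (i : ℝ)) + α * μ * (L : ℝ) - 1) /
            Real.Gamma (α * ((N : ℝ) + (i : ℝ)) + α * μ * (L : ℝ))| <
      (2 * (L : ℝ) / r) *
        (α * μ ^ μ * Real.Gamma (α * μ) * (r / rh) ^ (α * μ) / Real.Gamma μ) ^ L *
        Real.exp (μ * (r / rh) ^ α) * lowerGamma (N : ℝ) (μ * (r / rh) ^ α) /
        Real.Gamma (N : ℝ) := by
  have hα0 : 0 < α := by linarith
  have hL1 : (1 : ℝ) ≤ L := by exact_mod_cast hL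
  have ha : 0 < α * μ := by positivity
  have hΓaL : 0 < Real.Gamma (α * μ * L) := Real.Gamma_pos_of_pos (by positivity)
  set x := μ * (r / rh) ^ α with hx
  have hx0 : 0 < x := by positivity
  have hsum := hasSum_pow_div_factorial_tail_lowerGamma hN x
  set T := Real.exp x * lowerGamma N x / Real.Gamma N with hT
  have hT0 : 0 < T := by
    rw [← hsum.tsum_eq]
    exact hsum.summable.tsum_pos (fun i => by positivity) 0 (by positivity)
  have hterm (i : ℕ) : ‖deltaCoef α μ rh L (N + i) *
      r ^ (α * ((N : ℝ) + (i : ℝ)) + α * μ * (L : ℝ) - 1) /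
        Real.Gamma (α * ((N : ℝ) + (i : ℝ)) + α * μ * (L : ℝ))‖ ≤
      Real.Gamma (α * μ) ^ L / Real.Gamma (α * μ * L) * (r ^ (α * μ)) ^ L / r *
        (x ^ (N + i) / ((N + i).factorial : ℝ)) := by
    rw [← Nat.cast_add]
    set k := N + i
    have hΓk : 0 < Real.Gamma (α * (k : ℝ) + α * μ * L) := Real.Gamma_pos_of_pos (by positivity)
    have hrpow : r ^ (α * (k : ℝ) + α * μ * (L : ℝ) - 1) =
        (r ^ α) ^ k * (r ^ (α * μ)) ^ L / r := by
      rw [Real.rpow_sub hr, Real.rpow_add hr, Real.rpow_mul hr.le α, Real.rpow_mul hr.le (α * μ),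
        Real.rpow_natCast, Real.rpow_natCast, Real.rpow_one]
    have hxk : x = μ * rh ^ (-α) * r ^ α := by
      rw [hx, Real.div_rpow hr.le hrh.le, Real.rpow_neg hrh.le]
      ring
    rw [Real.norm_eq_abs, abs_div, abs_mul, abs_of_pos hΓk,
      abs_of_pos (Real.rpow_pos_of_pos hr _), div_le_iff₀ hΓk, deltaCoef_eq_coeff_pow_s11 rh ha]
    refine (mul_le_mul_of_nonneg_right (abs_coeff_deltaSeries_pow_le hα hμ hrh hL k)
      (by positivity)).trans_eq ?_
    rw [hrpow, hxk, mul_pow _ (r ^ α)]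
    ring
  have hbound := tsum_of_norm_bounded (hsum.mul_left _) hterm
  have hC : 0 < (α * μ ^ μ / (Real.Gamma μ * rh ^ (α * μ))) ^ L := by positivity
  have hconst : (α * μ ^ μ * Real.Gamma (α * μ) * (r / rh) ^ (α * μ) / Real.Gamma μ) ^ L =
      (α * μ ^ μ / (Real.Gamma μ * rh ^ (α * μ))) ^ L *
        (Real.Gamma (α * μ) ^ L * (r ^ (α * μ)) ^ L) := by
    rw [← mul_pow, ← mul_pow, Real.div_rpow hr.le hrh.le]
    congr 1
    field_simp
  have hinv : 1 / Real.Gamma (α * μ * L) < 2 * L := by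
    rw [div_lt_iff₀ hΓaL]
    nlinarith [half_lt_Gamma (show 0 < α * μ * L by positivity)]
  rw [abs_mul, abs_of_pos hC, hconst]
  set C := (α * μ ^ μ / (Real.Gamma μ * rh ^ (α * μ))) ^ L
  set D := Real.Gamma (α * μ) ^ L * (r ^ (α * μ)) ^ L with hD
  have hD0 : 0 < D := by positivity
  calc
    _ ≤ C * (Real.Gamma (α * μ) ^ L / Real.Gamma (α * μ * L) * (r ^ (α * μ)) ^ L / r * T) :=
      mul_le_mul_of_nonneg_left hbound hC.le
    _ = 1 / Real.Gamma (α * μ * L) * (C * D * T / r) := by rw [hD]; ring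
    _ < 2 * L * (C * D * T / r) := mul_lt_mul_of_pos_right hinv (by positivity)
    _ = _ := by rw [hT]; ring
end
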